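/- arXiv:1811.11087 — 9 statements merged into one kernel-verified Lean document; each statement's English description precedes it below -/
import Mathlib

section
/- Let λmax ∈ (0, 1], let f(x) = -x·ln(x) (with f(0)=0), and let q(x) = -(ln λmax)·x·(1-x). Then the function f - q is concave on the interval [0, λmax]. -/
theorem Real.neg_log_mul_two_le_inv {x : ℝ} (hx : 0 < x) : -Real.log x * 2 ≤ x⁻¹ := by
  have h := Real.log_le_sub_one_of_pos (show 0 < (2 * x)⁻¹ by positivity)
  rw [Real.log_inv, Real.log_mul two_ne_zero hx.ne', mul_inv] at h
  have h2 := Real.log_two_lt_d9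
  linarith

/-- For `λmax ∈ (0,1]`, `f x = -x ln x`, and the FINGER quadratic
`q x = -(ln λmax) x (1 - x)`, the function `f - q` is concave on `[0, λmax]`. -/
theorem finger_diff_concave (lmax : ℝ) (h0 : 0 < lmax) (h1 : lmax ≤ 1) :
    ConcaveOn ℝ (Set.Icc 0 lmax)
      (fun x => -(x * Real.log x) - (-(Real.log lmax) * x * (1 - x))) := by
  refine concaveOn_of_hasDerivWithinAt2_nonpos (convex_Icc 0 lmax)
    (f' := fun x => -(Real.log x + 1) - -Real.log lmax * (1 - 2 * x))
    (f'' := fun x => -x⁻¹ - -Real.log lmax * -2) ?_ ?_ ?_ ?_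
  · exact (Real.continuous_mul_log.neg.sub (by fun_prop)).continuousOn
  all_goals
    rw [interior_Icc]
    rintro x ⟨hx0, hx1⟩
  · have hq : HasDerivAt (fun x => -Real.log lmax * x * (1 - x))
        (-Real.log lmax * (1 - 2 * x)) x := by
      refine (((hasDerivAt_id' x).const_mul (-Real.log lmax)).mul
        ((hasDerivAt_id' x).const_sub 1)).congr_deriv ?_
      ring
    exact ((Real.hasDerivAt_mul_log hx0.ne').neg.sub hq).hasDerivWithinAt
  · have hq : HasDerivAt (fun x => -Real.log lmax * (1 - 2 * x)) (-Real.log lmax * -2) x := by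
      refine ((((hasDerivAt_id' x).const_mul 2).const_sub 1).const_mul
        (-Real.log lmax)).congr_deriv ?_
      ring
    exact (((Real.hasDerivAt_log hx0.ne').add_const 1).neg.sub hq).hasDerivWithinAt
  · have hinv : lmax⁻¹ ≤ x⁻¹ := inv_anti₀ hx0 hx1.le
    have hlog := Real.neg_log_mul_two_le_inv h0
    linarith
end

section
/- Let λmax ∈ (0, 1], let f(x) = -x·ln(x) (with f(0)=0), and let q(x) = -(ln λmax)·x·(1-x). Then for every x ∈ [0, λmax], f(x) - q(x) ≥ λmax·f(x). -/
/-- Chord form of the concavity of `log`: the slope of the chord to `1` is antitone. -/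
theorem one_sub_mul_log_le_one_sub_mul_log {x y : ℝ} (hx : 0 < x) (hxy : x ≤ y) (hy : y ≤ 1) :
    (1 - y) * Real.log x ≤ (1 - x) * Real.log y := by
  rcases (hxy.trans hy).eq_or_lt with rfl | hx1
  · simp [le_antisymm hy hxy]
  have hpos : 0 < 1 - x := sub_pos.2 hx1
  have h := strictConcaveOn_log_Ioi.concaveOn.2 (Set.mem_Ioi.2 hx) (Set.mem_Ioi.2 one_pos)
    (div_nonneg (sub_nonneg.2 hy) hpos.le) (div_nonneg (sub_nonneg.2 hxy) hpos.le)
    (by field_simp; ring)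
  have hcomb : (1 - y) / (1 - x) * x + (y - x) / (1 - x) * 1 = y := by
    field_simp
    ring
  simp only [smul_eq_mul, hcomb, Real.log_one, mul_zero, add_zero] at h
  rwa [div_mul_eq_mul_div, div_le_iff₀' hpos] at h

/-- For `λmax ∈ (0,1]`, `f x = -x ln x`, and the FINGER quadratic
`q x = -(ln λmax) x (1 - x)`, we have `f x - q x ≥ λmax * f x` on `[0, λmax]`. -/
theorem finger_diff_lower_bound (lmax : ℝ) (h0 : 0 < lmax) (h1 : lmax ≤ 1)
    (x : ℝ) (hx : x ∈ Set.Icc 0 lmax) :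
    -(x * Real.log x) - (-(Real.log lmax) * x * (1 - x)) ≥ lmax * (-(x * Real.log x)) := by
  rcases hx.1.eq_or_lt with rfl | hpos
  · simp
  · linarith [mul_le_mul_of_nonneg_left
      (one_sub_mul_log_le_one_sub_mul_log hpos hx.2 h1) hx.1]
end

section
/- Let (λ₁, …, λₙ) be a probability vector (λᵢ ≥ 0 for all i and ∑ᵢ λᵢ = 1), let λmax = maxᵢ λᵢ > 0, and let q(x) = -(ln λmax)·x·(1-x). Then ∑ᵢ q(λᵢ) ≥ q(λmax) + q(1-λmax); equivalently, the FINGER approximation satisfies Ĥ(λ₁,…,λₙ) ≥ Ĥ(λmax, 1-λmax). -/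
open scoped BigOperators

theorem sum_sq_le_sq_add_sq_sub {ι : Type*} {s : Finset ι} {f : ι → ℝ}
    (hf : ∀ i ∈ s, 0 ≤ f i) {k : ι} (hk : k ∈ s) :
    ∑ i ∈ s, f i ^ 2 ≤ f k ^ 2 + (∑ i ∈ s, f i - f k) ^ 2 := by
  classical
  rw [← Finset.add_sum_erase s f hk, ← Finset.add_sum_erase s (fun i => f i ^ 2) hk,
    add_sub_cancel_left]
  gcongr
  exact Finset.sum_sq_le_sq_sum_of_nonneg fun i hi => hf i (Finset.mem_of_mem_erase hi)

/-- For a probability vector with maximum entry `λmax > 0` and the FINGER quadratic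
`q x = -(ln λmax) x (1-x)`, we have `∑ᵢ q(λᵢ) ≥ q(λmax) + q(1 - λmax)`. -/
theorem finger_sum_ge_two_point (n : ℕ) (l : Fin n → ℝ)
    (h0 : ∀ i, 0 ≤ l i) (h1 : ∑ i, l i = 1)
    (lmax : ℝ) (hmax : IsGreatest (Set.range l) lmax) (hpos : 0 < lmax) :
    ∑ i, (-(Real.log lmax) * l i * (1 - l i))
      ≥ -(Real.log lmax) * lmax * (1 - lmax)
        + -(Real.log lmax) * (1 - lmax) * (1 - (1 - lmax)) := by
  obtain ⟨k, rfl⟩ := hmax.1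
  have hk : l k ≤ 1 :=
    h1 ▸ Finset.single_le_sum (fun i _ => h0 i) (Finset.mem_univ k)
  have hlog : 0 ≤ -Real.log (l k) := neg_nonneg.2 (Real.log_nonpos hpos.le hk)
  have hsq := sum_sq_le_sq_add_sq_sub (fun i _ => h0 i) (Finset.mem_univ k)
  rw [h1] at hsq
  have hsum : ∑ i, (-(Real.log (l k)) * l i * (1 - l i))
      = -Real.log (l k) * (∑ i, l i - ∑ i, l i ^ 2) := by
    rw [← Finset.sum_sub_distrib, Finset.mul_sum]
    exact Finset.sum_congr rfl fun i _ => by ring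
  rw [hsum, h1]
  linarith [mul_le_mul_of_nonneg_left hsq hlog]
end

section
/- Let (λ₁, …, λₙ) be a probability vector (λᵢ ≥ 0 for all i and ∑ᵢ λᵢ = 1) with λmax = maxᵢ λᵢ > 0. Then the entropy H = -∑ᵢ λᵢ·ln(λᵢ) satisfies H ≥ Ĥ, where Ĥ = -(ln λmax)·(1 - ∑ᵢ λᵢ²) is the FINGER approximation (convention 0·ln(0) = 0). -/
open scoped BigOperators

/-- The Shannon entropy `H = -∑ᵢ λᵢ ln λᵢ` of a probability vector dominates the
FINGER approximation `Ĥ = -(ln λmax)(1 - ∑ᵢ λᵢ²)`. -/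
theorem entropy_ge_finger (n : ℕ) (l : Fin n → ℝ)
    (h0 : ∀ i, 0 ≤ l i) (h1 : ∑ i, l i = 1)
    (lmax : ℝ) (hmax : IsGreatest (Set.range l) lmax) (hpos : 0 < lmax) :
    -∑ i, l i * Real.log (l i) ≥ -(Real.log lmax) * (1 - ∑ i, (l i) ^ 2) := by
  obtain ⟨⟨j, hj⟩, hub⟩ := hmax
  have hle : lmax ≤ 1 := by
    rw [← hj, ← h1]
    exact Finset.single_le_sum (fun i _ => h0 i) (Finset.mem_univ j)
  have hlog : Real.log lmax ≤ 0 := Real.log_nonpos hpos.le hle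
  have hsum : ∑ i, l i * Real.log (l i) ≤ Real.log lmax := by
    calc ∑ i, l i * Real.log (l i) ≤ ∑ i, l i * Real.log lmax := by
          refine Finset.sum_le_sum fun i _ => ?_
          rcases (h0 i).eq_or_lt with h | h
          · simp [← h]
          · exact mul_le_mul_of_nonneg_left (Real.log_le_log h (hub ⟨i, rfl⟩)) h.le
      _ = Real.log lmax := by rw [← Finset.sum_mul, h1, one_mul]
  have hsq : 0 ≤ ∑ i, (l i) ^ 2 := Finset.sum_nonneg fun i _ => sq_nonneg (l i)
  nlinarith [mul_nonneg (neg_nonneg.mpr hlog) hsq]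
end

section
/- Let (λ₁, …, λₙ) be a probability vector (λᵢ ≥ 0 for all i and ∑ᵢ λᵢ = 1) with λmax = maxᵢ λᵢ > 0. Then the entropy H = -∑ᵢ λᵢ·ln(λᵢ) equals the FINGER approximation Ĥ = -(ln λmax)·(1 - ∑ᵢ λᵢ²) if and only if λmax = 1. -/
open scoped BigOperators

/-- The Shannon entropy of a probability vector is at least its min-entropy. -/
theorem neg_log_le_entropy {ι : Type*} [Fintype ι] {l : ι → ℝ} {m : ℝ}
    (h0 : ∀ i, 0 ≤ l i) (h1 : ∑ i, l i = 1) (hle : ∀ i, l i ≤ m) :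
    -Real.log m ≤ -∑ i, l i * Real.log (l i) := by
  have h : ∑ i, l i * Real.log (l i) ≤ ∑ i, l i * Real.log m := by
    refine Finset.sum_le_sum fun i _ => ?_
    rcases (h0 i).eq_or_lt with hi | hi
    · simp [← hi]
    · exact mul_le_mul_of_nonneg_left (Real.log_le_log hi (hle i)) hi.le
  rw [← Finset.sum_mul, h1, one_mul] at h
  exact neg_le_neg h

/-- A probability vector with an entry equal to `1` has zero entropy. -/
theorem sum_mul_log_eq_zero_of_eq_one {ι : Type*} [Fintype ι] {l : ι → ℝ}
    (h0 : ∀ i, 0 ≤ l i) (h1 : ∑ i, l i = 1) {j : ι} (hj : l j = 1) :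
    ∑ i, l i * Real.log (l i) = 0 := by
  refine Finset.sum_eq_zero fun i _ => ?_
  by_cases hij : i = j
  · simp [hij, hj]
  · have h := Finset.add_le_sum (fun k _ => h0 k) (Finset.mem_univ i) (Finset.mem_univ j) hij
    have hi : l i = 0 := by linarith [h0 i]
    simp [hi]

/-- The Shannon entropy of a probability vector equals the FINGER approximation
`Ĥ = -(ln λmax)(1 - ∑ᵢ λᵢ²)` if and only if `λmax = 1`. -/
theorem entropy_eq_finger_iff (n : ℕ) (l : Fin n → ℝ)
    (h0 : ∀ i, 0 ≤ l i) (h1 : ∑ i, l i = 1)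
    (lmax : ℝ) (hmax : IsGreatest (Set.range l) lmax) (hpos : 0 < lmax) :
    (-∑ i, l i * Real.log (l i) = -(Real.log lmax) * (1 - ∑ i, (l i) ^ 2)) ↔ lmax = 1 := by
  obtain ⟨⟨j, hj⟩, hub⟩ := hmax
  have hle : ∀ i, l i ≤ lmax := fun i => hub ⟨i, rfl⟩
  constructor
  · intro h
    have hH := neg_log_le_entropy h0 h1 hle
    have hS : 0 < ∑ i, (l i) ^ 2 :=
      Finset.sum_pos' (fun i _ => sq_nonneg _) ⟨j, Finset.mem_univ j, by rw [hj]; positivity⟩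
    have hm : lmax ≤ 1 := by
      rw [← hj, ← h1]
      exact Finset.single_le_sum (fun i _ => h0 i) (Finset.mem_univ j)
    have hlog : 0 ≤ Real.log lmax := by
      refine nonneg_of_mul_nonneg_left ?_ hS
      linarith
    exact hm.antisymm ((Real.log_nonneg_iff hpos).mp hlog)
  · rintro rfl
    simp [sum_mul_log_eq_zero_of_eq_one h0 h1 hj]
end

section
/- Let (λ₁, …, λₙ) be a probability vector (λᵢ ≥ 0 for all i and ∑ᵢ λᵢ = 1) with λmax = maxᵢ λᵢ > 0, entropy H = -∑ᵢ λᵢ·ln(λᵢ), and FINGER approximation Ĥ = -(ln λmax)·(1 - ∑ᵢ λᵢ²). Then H - Ĥ ≥ λmax·H. -/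
open scoped BigOperators

/-- The secant slope of `Real.log` through `1` is antitone, in a division-free form. -/
lemma one_sub_mul_log_le {x m : ℝ} (hx : 0 < x) (hxm : x ≤ m) (hm : m ≤ 1) :
    (1 - m) * Real.log x ≤ (1 - x) * Real.log m := by
  rcases (hxm.trans hm).eq_or_lt with rfl | hx1
  · simp
  have hd : 0 < 1 - x := sub_pos.2 hx1
  have h := strictConcaveOn_log_Ioi.concaveOn.2 (Set.mem_Ioi.2 hx)
    (Set.mem_Ioi.2 one_pos) (div_nonneg (sub_nonneg.2 hm) hd.le)
    (div_nonneg (sub_nonneg.2 hxm) hd.le) (by field_simp; ring)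
  have hc : (1 - m) / (1 - x) * x + (m - x) / (1 - x) * 1 = m := by
    field_simp
    ring
  simp only [smul_eq_mul, hc, Real.log_one, mul_zero, add_zero] at h
  rwa [div_mul_eq_mul_div, div_le_iff₀ hd, mul_comm (Real.log m)] at h

/-- For a probability vector with entropy `H` and FINGER approximation `Ĥ`,
the error satisfies `H - Ĥ ≥ λmax * H`. -/
theorem entropy_sub_finger_ge (n : ℕ) (l : Fin n → ℝ)
    (h0 : ∀ i, 0 ≤ l i) (h1 : ∑ i, l i = 1)
    (lmax : ℝ) (hmax : IsGreatest (Set.range l) lmax) (hpos : 0 < lmax) :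
    (-∑ i, l i * Real.log (l i)) - (-(Real.log lmax) * (1 - ∑ i, (l i) ^ 2))
      ≥ lmax * (-∑ i, l i * Real.log (l i)) := by
  have hm : lmax ≤ 1 := by
    obtain ⟨i, rfl⟩ := hmax.1
    exact h1 ▸ Finset.single_le_sum (fun j _ => h0 j) (Finset.mem_univ i)
  have key : ∑ i, (1 - lmax) * (l i * Real.log (l i)) ≤
      ∑ i, (l i - l i ^ 2) * Real.log lmax := by
    refine Finset.sum_le_sum fun i _ => ?_
    rcases (h0 i).eq_or_lt with hi | hi
    · simp [← hi]
    · have := mul_le_mul_of_nonneg_left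
        (one_sub_mul_log_le hi (hmax.2 (Set.mem_range_self i)) hm) hi.le
      linarith
  rw [← Finset.mul_sum, ← Finset.sum_mul, Finset.sum_sub_distrib, h1] at key
  linarith
end

section
/- Let n ≥ 1 be an integer and let λmax be a real number with 1/n < λmax ≤ 1, and set σ = (-n·λmax·ln(n·λmax) + n·λmax - 1)/(n·(λmax - 1/n)²). Then 1/n ≤ -1/(2σ) ≤ λmax. -/
theorem log_le_half_sub_inv {x : ℝ} (hx : 1 ≤ x) : Real.log x ≤ (x - x⁻¹) / 2 := by
  rw [← Real.sinh_log (by linarith)]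
  exact Real.self_le_sinh_iff.2 (Real.log_nonneg hx)

/-- The second-order truncation of the series of `-log (1 - t)` at `t = 1 - x⁻¹`. -/
theorem one_sub_inv_add_sq_le_log {x : ℝ} (hx : 1 ≤ x) :
    (1 - x⁻¹) + (1 - x⁻¹) ^ 2 / 2 ≤ Real.log x := by
  have hx0 : 0 < x⁻¹ := by positivity
  have hx1 : x⁻¹ ≤ 1 := inv_le_one_of_one_le₀ hx
  have ht : 0 ≤ 1 - x⁻¹ := by linarith
  have hsum := Real.hasSum_pow_div_log_of_abs_lt_one
    (x := 1 - x⁻¹) (by rw [abs_of_nonneg ht]; linarith)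
  have h := sum_le_hasSum (Finset.range 2) (fun i _ => by positivity) hsum
  norm_num [Finset.sum_range_succ] at h
  exact h


/-- For `n ≥ 1`, `1/n < λmax ≤ 1`, and
`σ = (-nλmax ln(nλmax) + nλmax - 1)/(n(λmax - 1/n)²)`, we have `1/n ≤ -1/(2σ) ≤ λmax`. -/
theorem vertex_between (n : ℕ) (hn : 1 ≤ n) (lmax : ℝ)
    (h1 : 1 / (n : ℝ) < lmax) (h2 : lmax ≤ 1) (σ : ℝ)
    (hσ : σ = (-((n : ℝ) * lmax * Real.log ((n : ℝ) * lmax)) + (n : ℝ) * lmax - 1)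
      / ((n : ℝ) * (lmax - 1 / (n : ℝ)) ^ 2)) :
    1 / (n : ℝ) ≤ -1 / (2 * σ) ∧ -1 / (2 * σ) ≤ lmax := by
  have hn0 : (0 : ℝ) < n := by exact_mod_cast hn
  obtain ⟨x, hx⟩ : ∃ x : ℝ, x = n * lmax := ⟨_, rfl⟩
  have hl : lmax = x / n := by rw [hx]; field_simp
  have hx1 : 1 < x := by rwa [hx, ← div_lt_iff₀' hn0]
  have hx0 : 0 < x := by linarith
  have hxs : 0 < (x - 1) ^ 2 := pow_pos (by linarith) 2
  have hupper : 2 * (x * Real.log x - x + 1) ≤ (x - 1) ^ 2 := by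
    have h := mul_le_mul_of_nonneg_left (log_le_half_sub_inv hx1.le) hx0.le
    have e : x * ((x - x⁻¹) / 2) = (x ^ 2 - 1) / 2 := by field_simp
    linarith
  have hlower : (x - 1) ^ 2 ≤ x * (2 * (x * Real.log x - x + 1)) := by
    have h := mul_le_mul_of_nonneg_left (one_sub_inv_add_sq_le_log hx1.le) (sq_nonneg x)
    have e : x ^ 2 * ((1 - x⁻¹) + (1 - x⁻¹) ^ 2 / 2) = (3 * x ^ 2 - 4 * x + 1) / 2 := by
      field_simp
      ring
    linarith
  have hD : 0 < 2 * (x * Real.log x - x + 1) :=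
    pos_of_mul_pos_right (hxs.trans_le hlower) hx0.le
  have hvertex : -1 / (2 * σ) = (x - 1) ^ 2 / (2 * (x * Real.log x - x + 1)) / n := by
    have hden : (n : ℝ) * (lmax - 1 / n) ^ 2 = (x - 1) ^ 2 / n := by
      rw [hl]
      field_simp
    rw [hσ, hden, ← hx,
      show -(x * Real.log x) + x - 1 = -(x * Real.log x - x + 1) by ring]
    have hD' : x * Real.log x - x + 1 ≠ 0 := by linarith
    generalize x * Real.log x - x + 1 = D at hD'
    field_simp
  rw [hvertex, hl]
  constructor
  · gcongr
    rwa [one_le_div hD]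
  · gcongr
    rwa [div_le_iff₀ hD]
end

section
/- Let n ≥ 1 be an integer, let λmax be a real number with 1/n < λmax ≤ 1, set σ = (-n·λmax·ln(n·λmax) + n·λmax - 1)/(n·(λmax - 1/n)²), and let q(x) = σ·x² + (ln n - 1 - 2σ/n)·x + (σ+n)/n² and f(x) = -x·ln(x) (with f(0)=0). Then q(x) ≥ f(x) for every x ∈ [0, λmax]. -/
/-- The function `t ↦ t log t - t + 1 - (t - 1)² / 2` is antitone on `[0, ∞)`. -/
theorem antitoneOn_mul_log_sub_sq :
    AntitoneOn (fun t : ℝ => t * Real.log t - t + 1 - (t - 1) ^ 2 / 2) (Set.Ici 0) := by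
  refine antitoneOn_of_hasDerivWithinAt_nonpos (f' := fun t => Real.log t - (t - 1))
    (convex_Ici 0) ?_ ?_ ?_
  · have := Real.continuous_mul_log
    fun_prop
  · intro t ht
    rw [interior_Ici] at ht
    have h := ((((Real.hasDerivAt_mul_log (ne_of_gt ht)).sub (hasDerivAt_id t)).add_const 1).sub
      ((((hasDerivAt_id t).sub_const 1).pow 2).div_const 2)).hasDerivWithinAt
      (s := interior (Set.Ici (0 : ℝ)))
    refine h.congr_deriv ?_
    simp
  · intro t ht
    rw [interior_Ici] at ht
    have := Real.log_le_sub_one_of_pos ht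
    linarith

/-- The function `t ↦ (t log t - t + 1) / (t - 1)²` is antitone on `(1, ∞)`. -/
theorem antitoneOn_mul_log_div_sq :
    AntitoneOn (fun t : ℝ => (t * Real.log t - t + 1) / (t - 1) ^ 2) (Set.Ioi 1) := by
  have hd : ∀ t ∈ Set.Ioi (1 : ℝ),
      HasDerivAt (fun t : ℝ => (t * Real.log t - t + 1) / (t - 1) ^ 2)
        ((2 * (t - 1) - (t + 1) * Real.log t) / (t - 1) ^ 3) t := by
    intro t ht
    have ht1 : t - 1 ≠ 0 := sub_ne_zero.2 (ne_of_gt ht)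
    have ht0 : t ≠ 0 := ne_of_gt (zero_lt_one.trans ht)
    have h := (((Real.hasDerivAt_mul_log ht0).sub (hasDerivAt_id t)).add_const 1).div
      (((hasDerivAt_id t).sub_const 1).pow 2) (pow_ne_zero 2 ht1)
    refine h.congr_deriv ?_
    simp
    field_simp
    ring
  refine antitoneOn_of_hasDerivWithinAt_nonpos (convex_Ioi 1)
    (fun t ht => (hd t ht).continuousAt.continuousWithinAt)
    (fun t ht => (hd t (interior_subset ht)).hasDerivWithinAt) ?_
  intro t ht
  have ht : 1 < t := interior_subset ht
  have h := Real.le_log_one_add_of_nonneg (sub_nonneg.2 ht.le)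
  rw [add_sub_cancel, div_le_iff₀ (by linarith)] at h
  exact div_nonpos_of_nonpos_of_nonneg (by linarith) (pow_nonneg (by linarith) 3)

/-- The scale-free form of the quadratic bound. -/
theorem mul_log_ratio_mul_sq_le {T t : ℝ} (hT : 1 < T) (ht0 : 0 ≤ t) (htT : t ≤ T) :
    (T * Real.log T - T + 1) / (T - 1) ^ 2 * (t - 1) ^ 2 ≤ t * Real.log t - t + 1 := by
  have hT2 : 0 < (T - 1) ^ 2 := pow_pos (sub_pos.2 hT) 2
  rcases le_or_gt t 1 with ht | ht
  · have h₁ := antitoneOn_mul_log_sub_sq (Set.mem_Ici.2 zero_le_one)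
      (Set.mem_Ici.2 (zero_le_one.trans hT.le)) hT.le
    have h₂ := antitoneOn_mul_log_sub_sq (Set.mem_Ici.2 ht0) (Set.mem_Ici.2 zero_le_one) ht
    norm_num at h₁ h₂
    have hc : (T * Real.log T - T + 1) / (T - 1) ^ 2 ≤ 1 / 2 := by
      rw [div_le_iff₀ hT2]
      linarith
    nlinarith [mul_le_mul_of_nonneg_right hc (sq_nonneg (t - 1))]
  · have h := antitoneOn_mul_log_div_sq (Set.mem_Ioi.2 ht) (Set.mem_Ioi.2 hT) htT
    exact (le_div_iff₀ (pow_pos (sub_pos.2 ht) 2)).1 h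


/-- For `n ≥ 1`, `1/n < λmax ≤ 1`, and σ as in the modified Taylor approximation,
the quadratic `q x = σx² + (ln n - 1 - 2σ/n)x + (σ+n)/n²` dominates `f x = -x ln x`
on `[0, λmax]`. -/
theorem modified_taylor_dominates (n : ℕ) (hn : 1 ≤ n) (lmax : ℝ)
    (h1 : 1 / (n : ℝ) < lmax) (h2 : lmax ≤ 1) (σ : ℝ)
    (hσ : σ = (-((n : ℝ) * lmax * Real.log ((n : ℝ) * lmax)) + (n : ℝ) * lmax - 1)
      / ((n : ℝ) * (lmax - 1 / (n : ℝ)) ^ 2))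
    (x : ℝ) (hx : x ∈ Set.Icc 0 lmax) :
    σ * x ^ 2 + (Real.log n - 1 - 2 * σ / n) * x + (σ + n) / (n : ℝ) ^ 2
      ≥ -(x * Real.log x) := by
  have hn0 : (0 : ℝ) < n := by exact_mod_cast hn
  have hT : 1 < (n : ℝ) * lmax := by
    rwa [div_lt_iff₀ hn0, mul_comm] at h1
  have key := mul_log_ratio_mul_sq_le hT (mul_nonneg hn0.le hx.1)
    (mul_le_mul_of_nonneg_left hx.2 hn0.le)
  have hs : (n * lmax * Real.log (n * lmax) - n * lmax + 1) / (n * lmax - 1) ^ 2 = -σ / n := by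
    have h₁ : (n : ℝ) * lmax - 1 ≠ 0 := sub_ne_zero.2 hT.ne'
    have h₂ : lmax - 1 / (n : ℝ) = (n * lmax - 1) / n := by field_simp
    rw [hσ, h₂]
    field_simp
    ring
  have hlog : n * x * Real.log (n * x) = n * (x * Real.log n + x * Real.log x) := by
    rcases hx.1.eq_or_lt with rfl | hx0
    · simp
    · rw [Real.log_mul hn0.ne' hx0.ne']
      ring
  rw [hs, hlog] at key
  have hq : (n : ℝ) * (σ * x ^ 2 + (Real.log n - 1 - 2 * σ / n) * x + (σ + n) / (n : ℝ) ^ 2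
      + x * Real.log x) = n * (x * Real.log n + x * Real.log x) - n * x + 1
        - -σ / n * (n * x - 1) ^ 2 := by
    field_simp
    ring
  have := nonneg_of_mul_nonneg_right (hq.symm ▸ sub_nonneg.2 key) hn0
  linarith
end

section
/- Let (λ₁, …, λₙ) be a probability vector (λᵢ ≥ 0 for all i and ∑ᵢ λᵢ = 1) with λmax = maxᵢ λᵢ satisfying λmax > 1/n, and set σ = (-n·λmax·ln(n·λmax) + n·λmax - 1)/(n·(λmax - 1/n)²). Then the modified Taylor approximation T̂ = σ·(∑ᵢ λᵢ² - 1/n) + ln(n) satisfies T̂ ≥ H, where H = -∑ᵢ λᵢ·ln(λᵢ) is the entropy (convention 0·ln(0) = 0). -/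
open scoped BigOperators

/-- The remainder of `x ln x` over its second-order Taylor polynomial at `1` is decreasing. -/
lemma antitoneOn_mul_log_sub_taylor :
    AntitoneOn (fun x : ℝ => x * Real.log x - x + 1 - (x - 1) ^ 2 / 2) (Set.Ici 0) := by
  refine antitoneOn_of_hasDerivWithinAt_nonpos (convex_Ici 0)
    (f' := fun x => Real.log x - (x - 1)) ?_ ?_ ?_
  · exact (((Real.continuous_mul_log.sub continuous_id).add continuous_const).sub
      (by fun_prop)).continuousOn
  · intro x hx
    rw [interior_Ici, Set.mem_Ioi] at hx
    have h := (((Real.hasDerivAt_mul_log hx.ne').sub (hasDerivAt_id x)).add_const 1).sub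
      ((((hasDerivAt_id x).sub_const 1).pow 2).div_const 2)
    refine HasDerivAt.hasDerivWithinAt (h.congr_deriv ?_)
    simp
  · intro x hx
    rw [interior_Ici, Set.mem_Ioi] at hx
    linarith [Real.log_le_sub_one_of_pos hx]

lemma two_mul_sub_one_le_add_one_mul_log {x : ℝ} (hx : 1 ≤ x) :
    2 * (x - 1) ≤ (x + 1) * Real.log x := by
  have h := Real.le_log_one_add_of_nonneg (sub_nonneg.2 hx)
  rw [add_sub_cancel, div_le_iff₀ (by linarith)] at h
  linarith

lemma antitoneOn_mul_log_sub_add_one_div_sq :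
    AntitoneOn (fun x : ℝ => (x * Real.log x - x + 1) / (x - 1) ^ 2) (Set.Ioi 1) := by
  refine antitoneOn_of_hasDerivWithinAt_nonpos (convex_Ioi 1)
    (f' := fun x => (2 * (x - 1) - (x + 1) * Real.log x) / (x - 1) ^ 3) ?_ ?_ ?_
  · intro x hx
    have hx0 : x ≠ 0 := (zero_lt_one.trans hx).ne'
    have hx1 : (x - 1) ^ 2 ≠ 0 := pow_ne_zero 2 (sub_pos.2 hx).ne'
    exact ContinuousAt.continuousWithinAt (by fun_prop (disch := assumption))
  · intro x hx
    rw [interior_Ioi, Set.mem_Ioi] at hx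
    have hx0 : x ≠ 0 := (zero_lt_one.trans hx).ne'
    have hx1 : x - 1 ≠ 0 := (sub_pos.2 hx).ne'
    have h := (((Real.hasDerivAt_mul_log hx0).sub (hasDerivAt_id x)).add_const 1).div
      (((hasDerivAt_id x).sub_const 1).pow 2) (pow_ne_zero 2 hx1)
    refine HasDerivAt.hasDerivWithinAt (h.congr_deriv ?_)
    simp
    field_simp
    ring
  · intro x hx
    rw [interior_Ioi, Set.mem_Ioi] at hx
    exact div_nonpos_of_nonpos_of_nonneg
      (by linarith [two_mul_sub_one_le_add_one_mul_log hx.le])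
      (pow_nonneg (sub_nonneg.2 hx.le) 3)

lemma div_sq_mul_sq_le_mul_log_sub_add_one {a x : ℝ} (ha : 1 < a) (hx : 0 ≤ x) (hxa : x ≤ a) :
    (a * Real.log a - a + 1) / (a - 1) ^ 2 * (x - 1) ^ 2 ≤ x * Real.log x - x + 1 := by
  rcases le_or_gt x 1 with hx1 | hx1
  · have hl := antitoneOn_mul_log_sub_taylor hx (zero_le_one' ℝ) hx1
    have hr := antitoneOn_mul_log_sub_taylor (zero_le_one' ℝ) (zero_le_one.trans ha.le) ha.le
    simp at hl hr
    have hc : (a * Real.log a - a + 1) / (a - 1) ^ 2 ≤ 1 / 2 := by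
      rw [div_le_iff₀ (pow_pos (sub_pos.2 ha) 2)]
      linarith
    linarith [mul_le_mul_of_nonneg_right hc (sq_nonneg (x - 1))]
  · rw [← le_div_iff₀ (pow_pos (sub_pos.2 hx1) 2)]
    exact antitoneOn_mul_log_sub_add_one_div_sq hx1 ha hxa

/-- For a probability vector with maximum entry `λmax > 1/n`, the modified Taylor
approximation `T̂ = σ(∑ᵢ λᵢ² - 1/n) + ln n` dominates the entropy `H = -∑ᵢ λᵢ ln λᵢ`. -/
theorem modified_taylor_ge_entropy (n : ℕ) (l : Fin n → ℝ)
    (h0 : ∀ i, 0 ≤ l i) (h1 : ∑ i, l i = 1)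
    (lmax : ℝ) (hmax : IsGreatest (Set.range l) lmax) (hgt : 1 / (n : ℝ) < lmax)
    (σ : ℝ)
    (hσ : σ = (-((n : ℝ) * lmax * Real.log ((n : ℝ) * lmax)) + (n : ℝ) * lmax - 1)
      / ((n : ℝ) * (lmax - 1 / (n : ℝ)) ^ 2)) :
    σ * ((∑ i, (l i) ^ 2) - 1 / (n : ℝ)) + Real.log n ≥ -∑ i, l i * Real.log (l i) := by
  obtain ⟨i₀, -⟩ := hmax.1
  have hn : (0 : ℝ) < n := Nat.cast_pos.2 i₀.pos
  have ha : 1 < (n : ℝ) * lmax := by rwa [div_lt_iff₀' hn] at hgt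
  set c := ((n : ℝ) * lmax * Real.log (n * lmax) - n * lmax + 1) / (n * lmax - 1) ^ 2 with hc
  have hσc : σ = -(n * c) := by
    have hne : (n : ℝ) * lmax - 1 ≠ 0 := (sub_pos.2 ha).ne'
    have hd : lmax - 1 / (n : ℝ) = (n * lmax - 1) / n := by field_simp
    rw [hσ, hc, hd]
    field_simp
    ring
  have hterm (i : Fin n) : c * (n * l i - 1) ^ 2 ≤
      n * (l i * Real.log n + l i * Real.log (l i)) - n * l i + 1 := by
    have h := div_sq_mul_sq_le_mul_log_sub_add_one ha (mul_nonneg hn.le (h0 i))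
      (mul_le_mul_of_nonneg_left (hmax.2 ⟨i, rfl⟩) hn.le)
    rcases (h0 i).eq_or_lt with hi | hi
    · simpa [← hi] using h
    · rw [Real.log_mul hn.ne' hi.ne'] at h
      linarith
  have hsum := Finset.sum_le_sum fun i (_ : i ∈ Finset.univ) => hterm i
  have hsq : ∑ i, (n * l i - 1) ^ 2 = n ^ 2 * ∑ i, l i ^ 2 - n := by
    have hexp (i : Fin n) : (n * l i - 1) ^ 2 = n ^ 2 * l i ^ 2 - 2 * n * l i + 1 := by ring
    simp only [hexp, Finset.sum_add_distrib, Finset.sum_sub_distrib, ← Finset.mul_sum, h1,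
      Finset.sum_const, Finset.card_univ, Fintype.card_fin, nsmul_eq_mul]
    ring
  simp only [← Finset.mul_sum, hsq, Finset.sum_add_distrib, Finset.sum_sub_distrib,
    ← Finset.sum_mul, h1, Finset.sum_const, Finset.card_univ, Fintype.card_fin,
    nsmul_eq_mul] at hsum
  refine le_of_mul_le_mul_left ?_ hn
  have hmul : (n : ℝ) * (σ * (∑ i, l i ^ 2 - 1 / n) + Real.log n) =
      -(c * (n ^ 2 * ∑ i, l i ^ 2 - n)) + n * Real.log n := by
    rw [hσc]
    field_simp
  rw [hmul]
  linarith
end
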